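/- Let Δ be a simplicial complex on vertex set {1,…,r}. Then for all n ≥ 1, reg(I_Δ^{(n)}) ≤ δ(I_Δ)·(n − 1) + b, where b = max{reg(I_Γ) : Γ is a subcomplex of Δ with F(Γ) ⊆ F(Δ)}. -/

import Mathlib

open MvPolynomial Finset Filter

noncomputable section

/-- A family of potential faces (subsets of the vertex set `ι`). -/
abbrev FaceSet (ι : Type*) := Set (Finset ι)

/-- A face set is a simplicial complex if it is closed under taking subsets. -/
def IsSimplicialComplex {ι : Type*} (Δ : FaceSet ι) : Prop :=
  ∀ σ ∈ Δ, ∀ τ : Finset ι, τ ⊆ σ → τ ∈ Δ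

/-- The facets (maximal faces) of a face set. -/
def facets {ι : Type*} (Δ : FaceSet ι) : FaceSet ι :=
  {σ | σ ∈ Δ ∧ ∀ τ ∈ Δ, σ ⊆ τ → σ = τ}

/-- The Stanley–Reisner ideal of a simplicial complex: it is generated by the
square-free monomials corresponding to non-faces. -/
def srIdeal (K : Type*) [Field K] {ι : Type*} (Δ : FaceSet ι) :
    Ideal (MvPolynomial ι K) :=
  Ideal.span {p | ∃ τ : Finset ι, τ ∉ Δ ∧ p = ∏ i ∈ τ, X i}

/-- The `n`-th symbolic power `I^{(n)} = ⋂_{p ∈ Min(I)} (Iⁿ R_p ∩ R)`. -/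
def symbolicPower {R : Type*} [CommRing R] (I : Ideal R) (n : ℕ) : Ideal R :=
  ⨅ (p : Ideal R) (hp : p ∈ I.minimalPrimes),
    letI : p.IsPrime := hp.1.1
    (Ideal.map (algebraMap R (Localization.AtPrime p)) (I ^ n)).comap
      (algebraMap R (Localization.AtPrime p))

/-- The simplicial boundary operator on the space of chains (finitely supported
`K`-valued functions on finite subsets of `ι`), using the orientation coming
from the linear order of `ι`; a set of cardinality `d` is viewed as a
`(d-1)`-dimensional simplex, the empty set accounting for the augmentation. -/
def bdry (K : Type*) [Field K] {ι : Type*} [LinearOrder ι] :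
    (Finset ι →₀ K) →ₗ[K] (Finset ι →₀ K) :=
  Finsupp.lsum K fun σ => LinearMap.toSpanSingleton K _
    (∑ v ∈ σ, ((-1 : K) ^ (σ.filter fun w => w < v).card) • Finsupp.single (σ.erase v) (1 : K))

/-- The subspace of chains supported on the faces of `Δ` of cardinality `d`. -/
def cardFaces (K : Type*) [Field K] {ι : Type*} (Δ : FaceSet ι) (d : ℕ) :
    Submodule K (Finset ι →₀ K) :=
  Submodule.span K {f | ∃ σ ∈ Δ, σ.card = d ∧ f = Finsupp.single σ (1 : K)}

/-- `H̃ⱼ(Δ; K) ≠ 0`: there is a cycle of cardinality-degree `j + 1` which is not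
a boundary of a chain of `Δ`. -/
def HasNontrivialReducedHomology (K : Type*) [Field K] {ι : Type*} [LinearOrder ι]
    (Δ : FaceSet ι) (j : ℤ) : Prop :=
  ∃ d : ℕ, (d : ℤ) = j + 1 ∧
    ∃ z ∈ cardFaces K Δ d, bdry K z = 0 ∧ z ∉ ⇑(bdry K) '' ↑(cardFaces K Δ (d + 1))

/-- `G_α = {i : α_i < 0}`. -/
def negSupport {ι : Type*} [Fintype ι] (α : ι → ℤ) : Finset ι :=
  Finset.univ.filter fun i => α i < 0

/-- The degree complex `Δ_α(I) = {F ⊆ [r] \ G_α : x^α ∉ I·R_F}` of Takayama, where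
`x^α ∈ I·R_F` is expressed by saturation: `x^{α⁺}·(∏_{i ∈ F ∪ G_α} x_i)^m ∈ I` for some `m`. -/
def degreeComplex (K : Type*) [Field K] {ι : Type*} [Fintype ι] [LinearOrder ι]
    (I : Ideal (MvPolynomial ι K)) (α : ι → ℤ) : FaceSet ι :=
  {F | (∀ i ∈ F, 0 ≤ α i) ∧
    ¬∃ m : ℕ,
      monomial (Finsupp.equivFunOnFinite.symm fun i => (α i).toNat) (1 : K) *
        (∏ i ∈ F ∪ negSupport α, X i) ^ m ∈ I}

/-- Nonvanishing of the graded piece `H_𝔪^i(R/I)_α` of local cohomology of a monomial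
quotient, expressed via Takayama's formula
`dim_K H_𝔪^i(R/I)_α = dim_K H̃_{i-|G_α|-1}(Δ_α(I); K)`. -/
def lcNonzero (K : Type*) [Field K] {ι : Type*} [Fintype ι] [LinearOrder ι]
    (I : Ideal (MvPolynomial ι K)) (i : ℕ) (α : ι → ℤ) : Prop :=
  HasNontrivialReducedHomology K (degreeComplex K I α) ((i : ℤ) - (negSupport α).card - 1)

/-- The `a_i`-invariant `a_i(R/I) = max{t : H_𝔪^i(R/I)_t ≠ 0}` of a monomial quotient
(`H_𝔪^i(R/I)_t = ⊕_{|α| = t} H_𝔪^i(R/I)_α`). -/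
def aInv (K : Type*) [Field K] {ι : Type*} [Fintype ι] [LinearOrder ι]
    (I : Ideal (MvPolynomial ι K)) (i : ℕ) : ℤ :=
  sSup {z : ℤ | ∃ α : ι → ℤ, lcNonzero K I i α ∧ z = ∑ j, α j}

/-- The Castelnuovo–Mumford regularity `reg(R/I) = max_i (a_i(R/I) + i)` of a
monomial quotient. -/
def regQuot (K : Type*) [Field K] {ι : Type*} [Fintype ι] [LinearOrder ι]
    (I : Ideal (MvPolynomial ι K)) : ℤ :=
  sSup {z : ℤ | ∃ (i : ℕ) (α : ι → ℤ), lcNonzero K I i α ∧ z = (∑ j, α j) + i}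

/-- The Castelnuovo–Mumford regularity of a (monomial) ideal: `reg(I) = reg(R/I) + 1`. -/
def reg (K : Type*) [Field K] {ι : Type*} [Fintype ι] [LinearOrder ι]
    (I : Ideal (MvPolynomial ι K)) : ℤ :=
  regQuot K I + 1

/-- The depth `min{i : H_𝔪^i(R/I) ≠ 0}` of a monomial quotient. -/
def depthQuot (K : Type*) [Field K] {ι : Type*} [Fintype ι] [LinearOrder ι]
    (I : Ideal (MvPolynomial ι K)) : ℕ :=
  sInf {i : ℕ | ∃ α : ι → ℤ, lcNonzero K I i α}

/-- The projective dimension `pd(R/I) = r - depth(R/I)` (Auslander–Buchsbaum). -/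
def pdQuot (K : Type*) [Field K] {ι : Type*} [Fintype ι] [LinearOrder ι]
    (I : Ideal (MvPolynomial ι K)) : ℤ :=
  (Fintype.card ι : ℤ) - depthQuot K I

end

section MonomialIdeals

variable {K : Type*} [Field K] {ι : Type*}

/-- The prime ideal generated by the variables outside `F`. -/
noncomputable def varIdeal (K : Type*) [Field K] {ι : Type*} (F : Finset ι) :
    Ideal (MvPolynomial ι K) :=
  Ideal.span (X '' {i | i ∉ F})

lemma X_mem_varIdeal {F : Finset ι} {i : ι} (hi : i ∉ F) :
    (X i : MvPolynomial ι K) ∈ varIdeal K F :=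
  Ideal.subset_span ⟨i, hi, rfl⟩

lemma varIdeal_eq_ker [DecidableEq ι] (F : Finset ι) :
    varIdeal K F = RingHom.ker
      (aeval (fun i => if i ∈ F then X i else 0) : MvPolynomial ι K →ₐ[K] MvPolynomial ι K) := by
  apply le_antisymm
  · rw [varIdeal, Ideal.span_le]
    rintro _ ⟨i, hi, rfl⟩
    have hi' : i ∉ F := hi
    simp [RingHom.mem_ker, hi']
  · intro p hp
    rw [RingHom.mem_ker] at hp
    have key : ((Ideal.Quotient.mkₐ K (varIdeal K F)).comp
        (aeval (fun i => if i ∈ F then X i else 0) : MvPolynomial ι K →ₐ[K] MvPolynomial ι K)) =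
        Ideal.Quotient.mkₐ K (varIdeal K F) := by
      apply MvPolynomial.algHom_ext
      intro i
      by_cases hi : i ∈ F
      · simp [hi]
      · have := Ideal.Quotient.eq_zero_iff_mem.2 (X_mem_varIdeal (K := K) hi)
        simp [hi, this]
    have := DFunLike.congr_fun key p
    rw [AlgHom.comp_apply] at this
    erw [hp] at this
    exact Ideal.Quotient.eq_zero_iff_mem.1 (by simpa using this.symm)

lemma varIdeal_isPrime (F : Finset ι) : (varIdeal K F).IsPrime := by
  classical
  rw [varIdeal_eq_ker]
  exact RingHom.ker_isPrime _

lemma prod_X_notMem_varIdeal (F : Finset ι) :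
    ∏ i ∈ F, (X i : MvPolynomial ι K) ∉ varIdeal K F := by
  classical
  rw [varIdeal_eq_ker, RingHom.mem_ker]
  rw [map_prod, Finset.prod_congr rfl (g := fun i => (X i : MvPolynomial ι K))
    (fun i hi => by simp [hi])]
  exact Finset.prod_ne_zero_iff.2 fun i _ => X_ne_zero i

lemma exists_mem_support_of_notMem_varIdeal {F : Finset ι} {p : MvPolynomial ι K}
    (hp : p ∉ varIdeal K F) : ∃ c ∈ p.support, ∀ i ∉ F, c i = 0 := by
  rw [varIdeal, mem_ideal_span_X_image] at hp
  push Not at hp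
  exact hp

/-- The polynomials all of whose monomials have degree at least `k` in the variables outside
`F`. -/
noncomputable def degreeIdeal (K : Type*) [Field K] {ι : Type*} [Fintype ι] [DecidableEq ι]
    (F : Finset ι) (k : ℕ) : Ideal (MvPolynomial ι K) where
  carrier := {p | ∀ c ∈ p.support, k ≤ ∑ i ∈ Fᶜ, c i}
  zero_mem' := by simp
  add_mem' := by
    intro p q hp hq c hc
    rcases Finset.mem_union.1 (MvPolynomial.support_add hc) with h | h
    exacts [hp c h, hq c h]
  smul_mem' := by
    intro p q hq c hc
    obtain ⟨a, -, e, he, rfl⟩ := Finset.mem_add.1 (MvPolynomial.support_mul p q hc)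
    have := hq e he
    simp only [Finsupp.add_apply, Finset.sum_add_distrib]
    omega

lemma varIdeal_pow_le_degreeIdeal [Fintype ι] [DecidableEq ι] (F : Finset ι) (k : ℕ) :
    varIdeal K F ^ k ≤ degreeIdeal K F k := by
  induction k with
  | zero => intro p _ c _; exact Nat.zero_le _
  | succ k ih =>
    rw [pow_succ, Ideal.mul_le]
    intro p hp q hq c hc
    obtain ⟨a, ha, e, he, rfl⟩ := Finset.mem_add.1 (MvPolynomial.support_mul p q hc)
    have h1 := ih hp a ha
    rw [varIdeal, mem_ideal_span_X_image] at hq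
    obtain ⟨i, hi, hei⟩ := hq e he
    have h2 : e i ≤ ∑ i ∈ Fᶜ, e i :=
      Finset.single_le_sum (f := fun i => e i) (fun _ _ => Nat.zero_le _) (by simpa using hi)
    simp only [Finsupp.add_apply, Finset.sum_add_distrib]
    omega

lemma monomial_eq_prod_X_pow [Fintype ι] (a : ι →₀ ℕ) :
    monomial a (1 : K) = ∏ i, (X i : MvPolynomial ι K) ^ a i := by
  rw [monomial_eq, C_1, one_mul, Finsupp.prod_fintype _ _ (by simp)]

end MonomialIdeals

section SymbolicPower

variable {K : Type*} [Field K] {ι : Type*}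

lemma prod_X_mem_srIdeal {Δ : FaceSet ι} {τ : Finset ι} (h : τ ∉ Δ) :
    ∏ i ∈ τ, (X i : MvPolynomial ι K) ∈ srIdeal K Δ :=
  Ideal.subset_span ⟨τ, h, rfl⟩

lemma srIdeal_le_varIdeal {Δ : FaceSet ι} (hΔ : IsSimplicialComplex Δ) {F : Finset ι}
    (hF : F ∈ Δ) : srIdeal K Δ ≤ varIdeal K F := by
  rw [srIdeal, Ideal.span_le]
  rintro _ ⟨τ, hτ, rfl⟩
  obtain ⟨i, hi, hiF⟩ := Finset.not_subset.1 fun h => hτ (hΔ F hF τ h)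
  exact Ideal.mem_of_dvd _ (Finset.dvd_prod_of_mem _ hi) (X_mem_varIdeal hiF)

lemma X_mul_prod_X_mem_srIdeal {Δ : FaceSet ι} {F : Finset ι} (hF : F ∈ facets Δ) {i : ι}
    (hi : i ∉ F) : X i * ∏ j ∈ F, (X j : MvPolynomial ι K) ∈ srIdeal K Δ := by
  classical
  rw [← Finset.prod_insert hi]
  refine prod_X_mem_srIdeal fun h => hi ?_
  rw [hF.2 _ h (Finset.subset_insert i F)]
  exact Finset.mem_insert_self i F

lemma exists_facet_superset [Finite ι] {Δ : FaceSet ι} {τ : Finset ι} (h : τ ∈ Δ) :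
    ∃ F ∈ facets Δ, τ ⊆ F := by
  obtain ⟨F, hF, hmax⟩ := (Set.toFinite (Δ : Set (Finset ι))).exists_le_maximal h
  exact ⟨F, ⟨hmax.1, fun σ hσ hs => le_antisymm hs (hmax.2 hσ hs)⟩, hF⟩

lemma minimalPrimes_srIdeal [Finite ι] {Δ : FaceSet ι} (hΔ : IsSimplicialComplex Δ) :
    (srIdeal K Δ).minimalPrimes = varIdeal K '' facets Δ := by
  classical
  have := Fintype.ofFinite ι
  ext Q
  constructor
  · intro hQ
    have hQp : Q.IsPrime := hQ.1.1
    have hT : (Finset.univ.filter fun i => (X i : MvPolynomial ι K) ∉ Q) ∈ Δ := by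
      by_contra hT
      obtain ⟨i, hi, hiQ⟩ := (hQp.prod_mem_iff).1 (hQ.1.2 (prod_X_mem_srIdeal hT))
      exact (Finset.mem_filter.1 hi).2 hiQ
    obtain ⟨F, hF, hTF⟩ := exists_facet_superset hT
    refine ⟨F, hF, ?_⟩
    have hle : varIdeal K F ≤ Q := by
      rw [varIdeal, Ideal.span_le]
      rintro _ ⟨i, hi, rfl⟩
      by_contra hiQ
      exact hi (hTF (Finset.mem_filter.2 ⟨Finset.mem_univ _, hiQ⟩))
    exact le_antisymm hle (hQ.2 ⟨varIdeal_isPrime F, srIdeal_le_varIdeal hΔ hF.1⟩ hle)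
  · rintro ⟨F, hF, rfl⟩
    refine ⟨⟨varIdeal_isPrime F, srIdeal_le_varIdeal hΔ hF.1⟩, ?_⟩
    rintro Q ⟨hQp, hIQ⟩ hQF
    rw [varIdeal, Ideal.span_le]
    rintro _ ⟨i, hi, rfl⟩
    exact (hQp.mem_or_mem (hIQ (X_mul_prod_X_mem_srIdeal hF hi))).resolve_right
      fun h => prod_X_notMem_varIdeal F (hQF h)

lemma exists_mul_monomial_mem_srIdeal_pow_iff [Fintype ι] [DecidableEq ι] {Δ : FaceSet ι}
    (hΔ : IsSimplicialComplex Δ) {F : Finset ι} (hF : F ∈ facets Δ) (n : ℕ) (a : ι →₀ ℕ) :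
    (∃ u ∉ varIdeal K F, u * monomial a 1 ∈ srIdeal K Δ ^ n) ↔ n ≤ ∑ i ∈ Fᶜ, a i := by
  constructor
  · rintro ⟨u, hu, hmem⟩
    obtain ⟨c, hc, hc0⟩ := exists_mem_support_of_notMem_varIdeal hu
    have h := varIdeal_pow_le_degreeIdeal F n
      (Ideal.pow_right_mono (srIdeal_le_varIdeal hΔ hF.1) n hmem) (c + a) (by
        rw [mem_support_iff, coeff_mul_monomial, mul_one]
        exact mem_support_iff.1 hc)
    simp only [Finsupp.add_apply, Finset.sum_add_distrib] at h
    rwa [Finset.sum_eq_zero (s := Fᶜ) (f := fun i => c i)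
      (fun i hi => hc0 i (Finset.mem_compl.1 hi)), zero_add] at h
  · intro h
    have hprime := varIdeal_isPrime (K := K) F
    refine ⟨(∏ j ∈ F, X j) ^ (∑ i ∈ Fᶜ, a i),
      fun hu => prod_X_notMem_varIdeal F (hprime.mem_of_pow_mem _ hu), ?_⟩
    refine Ideal.pow_le_pow_right h ?_
    rw [monomial_eq_prod_X_pow, ← Finset.prod_compl_mul_prod F, ← mul_assoc]
    refine Ideal.mul_mem_right _ _ ?_
    rw [← Finset.prod_pow_eq_pow_sum, ← Finset.prod_pow_eq_pow_sum, ← Finset.prod_mul_distrib]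
    refine Ideal.prod_mem_prod fun i hi => ?_
    rw [← mul_pow, mul_comm]
    exact Ideal.pow_mem_pow (X_mul_prod_X_mem_srIdeal hF (Finset.mem_compl.1 hi)) _

/-- A monomial lies in the `n`-th symbolic power of a Stanley–Reisner ideal iff for every facet
it has degree at least `n` in the variables outside that facet. -/
lemma monomial_mem_symbolicPower_iff [Fintype ι] [DecidableEq ι] {Δ : FaceSet ι}
    (hΔ : IsSimplicialComplex Δ) (n : ℕ) (a : ι →₀ ℕ) :
    monomial a (1 : K) ∈ symbolicPower (srIdeal K Δ) n ↔
      ∀ F ∈ facets Δ, n ≤ ∑ i ∈ Fᶜ, a i := by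
  have hmem : ∀ (p : Ideal (MvPolynomial ι K)) [p.IsPrime],
      monomial a (1 : K) ∈ (Ideal.map (algebraMap _ (Localization.AtPrime p))
        (srIdeal K Δ ^ n)).comap (algebraMap _ (Localization.AtPrime p)) ↔
      ∃ u ∉ p, u * monomial a 1 ∈ srIdeal K Δ ^ n := fun p _ => by
    rw [Ideal.mem_comap, IsLocalization.algebraMap_mem_map_algebraMap_iff p.primeCompl]
    rfl
  simp only [symbolicPower, Ideal.mem_iInf]
  constructor
  · intro h F hF
    have hF' : varIdeal K F ∈ (srIdeal K Δ).minimalPrimes := by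
      rw [minimalPrimes_srIdeal hΔ]
      exact ⟨F, hF, rfl⟩
    have := varIdeal_isPrime (K := K) F
    exact (exists_mul_monomial_mem_srIdeal_pow_iff hΔ hF n a).1 ((hmem _).1 (h _ hF'))
  · intro h p hp
    obtain ⟨F, hF, rfl⟩ := (minimalPrimes_srIdeal hΔ).subset hp
    have := varIdeal_isPrime (K := K) F
    exact (hmem _).2 ((exists_mul_monomial_mem_srIdeal_pow_iff hΔ hF n a).2 (h F hF))

lemma monomial_mem_srIdeal_iff {Δ : FaceSet ι} (hΔ : IsSimplicialComplex Δ) (a : ι →₀ ℕ) :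
    monomial a (1 : K) ∈ srIdeal K Δ ↔ a.support ∉ Δ := by
  classical
  constructor
  · intro h ha
    have h' := srIdeal_le_varIdeal hΔ ha h
    rw [varIdeal, mem_ideal_span_X_image] at h'
    obtain ⟨i, hi, hai⟩ := h' a (by simp [mem_support_iff])
    exact hi (Finsupp.mem_support_iff.2 hai)
  · intro h
    refine Ideal.mem_of_dvd _ ?_ (prod_X_mem_srIdeal h)
    rw [monomial_eq, C_1, one_mul, Finsupp.prod]
    exact Finset.prod_dvd_prod_of_dvd _ _ fun i hi =>
      dvd_pow_self _ (Finsupp.mem_support_iff.1 hi)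

end SymbolicPower

section ReducedHomology

variable {K : Type*} [Field K] {ι : Type*}

lemma exists_card_eq_of_mem_cardFaces_ne_zero {Δ : FaceSet ι} {d : ℕ} {z : Finset ι →₀ K}
    (hz : z ∈ cardFaces K Δ d) (h0 : z ≠ 0) : ∃ σ ∈ Δ, σ.card = d := by
  by_contra! h
  refine h0 ((Submodule.mem_bot K).1 ?_)
  have : cardFaces K Δ d ≤ ⊥ := by
    rw [cardFaces, Submodule.span_le]
    rintro _ ⟨σ, hσ, hd, rfl⟩
    exact absurd hd (h σ hσ)
  exact this hz

variable [LinearOrder ι]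

lemma bdry_single (σ : Finset ι) :
    bdry K (Finsupp.single σ 1) = ∑ v ∈ σ, ((-1 : K) ^ (σ.filter fun w => w < v).card) •
      Finsupp.single (σ.erase v) (1 : K) := by
  simp [bdry]

/-- The contracting homotopy of a cone with apex `j`. -/
noncomputable def coneHomotopy (K : Type*) [Field K] {ι : Type*} [LinearOrder ι] (j : ι) :
    (Finset ι →₀ K) →ₗ[K] (Finset ι →₀ K) :=
  Finsupp.lsum K fun σ => LinearMap.toSpanSingleton K _
    (if j ∈ σ then 0
      else ((-1 : K) ^ (σ.filter fun w => w < j).card) • Finsupp.single (insert j σ) (1 : K))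

lemma coneHomotopy_single (j : ι) (σ : Finset ι) :
    coneHomotopy K j (Finsupp.single σ 1) = if j ∈ σ then 0
      else ((-1 : K) ^ (σ.filter fun w => w < j).card) • Finsupp.single (insert j σ) (1 : K) := by
  simp [coneHomotopy]

lemma neg_one_pow_card_filter_lt_insert_mul (σ : Finset ι) {v j : ι} (hv : v ∈ σ) (hj : j ∉ σ) :
    (-1 : K) ^ (σ.filter fun w => w < j).card *
        (-1 : K) ^ ((insert j σ).filter fun w => w < v).card +
      (-1 : K) ^ (σ.filter fun w => w < v).card *
        (-1 : K) ^ ((σ.erase v).filter fun w => w < j).card = 0 := by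
  rcases lt_trichotomy v j with h | rfl | h
  · have h1 : (insert j σ).filter (fun w => w < v) = σ.filter fun w => w < v := by
      rw [Finset.filter_insert, if_neg h.asymm]
    have h2 : (σ.filter fun w => w < j).card = ((σ.erase v).filter fun w => w < j).card + 1 := by
      rw [Finset.filter_erase, Finset.card_erase_add_one (by simp [hv, h])]
    rw [h1, h2, pow_succ]
    ring
  · exact absurd hv hj
  · have h1 : ((insert j σ).filter fun w => w < v).card = (σ.filter fun w => w < v).card + 1 := by
      rw [Finset.filter_insert, if_pos h, Finset.card_insert_of_notMem (by simp [hj])]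
    have h2 : (σ.erase v).filter (fun w => w < j) = σ.filter fun w => w < j := by
      rw [Finset.filter_erase, Finset.erase_eq_of_notMem (by simp [h.le])]
    rw [h1, h2, pow_succ]
    ring

lemma neg_one_pow_mul_self (m : ℕ) : (-1 : K) ^ m * (-1 : K) ^ m = 1 := by
  rw [← mul_pow]
  simp

lemma bdry_coneHomotopy_add (j : ι) (z : Finset ι →₀ K) :
    bdry K (coneHomotopy K j z) + coneHomotopy K j (bdry K z) = z := by
  suffices h : bdry K ∘ₗ coneHomotopy K j + coneHomotopy K j ∘ₗ bdry K = LinearMap.id from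
    DFunLike.congr_fun h z
  refine Finsupp.lhom_ext' fun σ => LinearMap.ext_ring ?_
  simp only [LinearMap.comp_apply, LinearMap.add_apply, Finsupp.lsingle_apply, LinearMap.id_apply]
  rw [bdry_single, coneHomotopy_single, map_sum]
  simp only [map_smul, coneHomotopy_single]
  by_cases hj : j ∈ σ
  · rw [if_pos hj, map_zero, zero_add, Finset.sum_eq_single_of_mem j hj]
    · rw [if_neg (Finset.notMem_erase j σ), Finset.insert_erase hj, smul_smul,
        Finset.filter_erase, Finset.erase_eq_of_notMem (by simp), neg_one_pow_mul_self, one_smul]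
    · intro v _ hvj
      rw [if_pos (Finset.mem_erase.2 ⟨hvj.symm, hj⟩), smul_zero]
  · rw [if_neg hj, map_smul, bdry_single, Finset.sum_insert hj, smul_add, smul_smul,
      Finset.erase_insert hj, Finset.filter_insert, if_neg (lt_irrefl j), neg_one_pow_mul_self,
      one_smul, add_assoc, Finset.smul_sum, ← Finset.sum_add_distrib]
    refine add_eq_left.2 (Finset.sum_eq_zero fun v hv => ?_)
    have hvj : j ≠ v := fun h => hj (h ▸ hv)
    rw [if_neg fun h => hj (Finset.mem_of_mem_erase h), smul_smul, smul_smul,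
      Finset.erase_insert_of_ne hvj, ← add_smul,
      neg_one_pow_card_filter_lt_insert_mul σ hv hj, zero_smul]

lemma coneHomotopy_mem_cardFaces {Δ : FaceSet ι} {j : ι} (h : ∀ F ∈ Δ, insert j F ∈ Δ) {d : ℕ}
    {z : Finset ι →₀ K} (hz : z ∈ cardFaces K Δ d) :
    coneHomotopy K j z ∈ cardFaces K Δ (d + 1) := by
  have : cardFaces K Δ d ≤ (cardFaces K Δ (d + 1)).comap (coneHomotopy K j) := by
    conv_lhs => rw [cardFaces]
    rw [Submodule.span_le]
    rintro _ ⟨σ, hσ, rfl, rfl⟩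
    rw [SetLike.mem_coe, Submodule.mem_comap, coneHomotopy_single]
    split_ifs with hj
    · exact zero_mem _
    · exact Submodule.smul_mem _ _ (Submodule.subset_span
        ⟨_, h σ hσ, Finset.card_insert_of_notMem hj, rfl⟩)
  exact this hz

lemma not_hasNontrivialReducedHomology_of_cone {Δ : FaceSet ι} {j : ι}
    (h : ∀ F ∈ Δ, insert j F ∈ Δ) (k : ℤ) : ¬HasNontrivialReducedHomology K Δ k := by
  rintro ⟨d, -, z, hz, hbz, hnz⟩
  refine hnz ⟨coneHomotopy K j z, coneHomotopy_mem_cardFaces h hz, ?_⟩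
  simpa [hbz] using bdry_coneHomotopy_add j z

end ReducedHomology

section DegreeComplex

variable {K : Type*} [Field K] {ι : Type*} [Fintype ι]

lemma mem_negSupport {α : ι → ℤ} {i : ι} : i ∈ negSupport α ↔ α i < 0 := by
  simp [negSupport]

lemma monomial_mul_prod_X_pow [DecidableEq ι] (a : ι →₀ ℕ) (S : Finset ι) (m : ℕ) :
    monomial a (1 : K) * (∏ i ∈ S, X i) ^ m =
      monomial (a + Finsupp.equivFunOnFinite.symm fun i => if i ∈ S then m else 0) 1 := by
  have : (∏ i ∈ S, (X i : MvPolynomial ι K)) ^ m =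
      monomial (Finsupp.equivFunOnFinite.symm fun i => if i ∈ S then m else 0) 1 := by
    rw [monomial_eq_prod_X_pow, ← Finset.prod_pow]
    simp [pow_ite, Finset.prod_ite_mem]
  rw [this, monomial_mul, one_mul]

variable [LinearOrder ι]

lemma mem_degreeComplex_symbolicPower {Δ : FaceSet ι} (hΔ : IsSimplicialComplex Δ) (n : ℕ)
    (α : ι → ℤ) (F : Finset ι) :
    F ∈ degreeComplex K (symbolicPower (srIdeal K Δ) n) α ↔ (∀ i ∈ F, 0 ≤ α i) ∧
      ∃ H ∈ facets Δ, F ∪ negSupport α ⊆ H ∧ ∑ i ∈ Hᶜ, (α i).toNat < n := by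
  refine and_congr_right fun _ => ?_
  simp only [monomial_mul_prod_X_pow, monomial_mem_symbolicPower_iff hΔ]
  constructor
  · intro h
    by_contra! hH
    refine h ⟨n, fun H hHf => ?_⟩
    simp only [Finsupp.add_apply, Finsupp.equivFunOnFinite_symm_apply_apply,
      Finset.sum_add_distrib]
    by_cases hsub : F ∪ negSupport α ⊆ H
    · exact le_add_right (hH H hHf hsub)
    · obtain ⟨i, hi, hiH⟩ := Finset.not_subset.1 hsub
      refine le_add_left ?_
      have := Finset.single_le_sum (s := Hᶜ) (f := fun j => if j ∈ F ∪ negSupport α then n else 0)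
        (fun _ _ => Nat.zero_le _) (Finset.mem_compl.2 hiH)
      simpa only [if_pos hi] using this
  · rintro ⟨H, hHf, hsub, hlt⟩ ⟨m, hm⟩
    have := hm H hHf
    simp only [Finsupp.add_apply, Finsupp.equivFunOnFinite_symm_apply_apply,
      Finset.sum_add_distrib] at this
    rw [Finset.sum_eq_zero (f := fun i => if i ∈ F ∪ negSupport α then m else 0)
      fun i hi => if_neg fun h => Finset.mem_compl.1 hi (hsub h)] at this
    omega

lemma mem_degreeComplex_srIdeal {Γ : FaceSet ι} (hΓ : IsSimplicialComplex Γ)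
    (α : ι → ℤ) (F : Finset ι) :
    F ∈ degreeComplex K (srIdeal K Γ) α ↔ (∀ i ∈ F, 0 ≤ α i) ∧
      (F ∪ Finset.univ.filter fun i => α i ≠ 0) ∈ Γ := by
  refine and_congr_right fun hF => ?_
  simp only [monomial_mul_prod_X_pow, monomial_mem_srIdeal_iff hΓ]
  have hunion : ∀ i, i ∈ (F ∪ Finset.univ.filter fun i => α i ≠ 0) ↔
      i ∈ F ∪ negSupport α ∨ 0 < α i := fun i => by
    simp only [Finset.mem_union, Finset.mem_filter, Finset.mem_univ, true_and, mem_negSupport,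
      or_assoc, ne_iff_lt_or_gt]
  constructor
  · intro h
    by_contra hnot
    refine h ⟨1, fun hmem => hnot ?_⟩
    convert hmem using 1
    ext i
    rw [hunion]
    simp only [Finsupp.mem_support_iff, Finsupp.add_apply,
      Finsupp.equivFunOnFinite_symm_apply_apply]
    split_ifs with h
    · simp [h]
    · simp [h]
  · rintro h ⟨m, hm⟩
    refine hm (hΓ _ h _ fun i hi => (hunion i).2 ?_)
    by_contra! hcon
    refine Finsupp.mem_support_iff.1 hi ?_
    simp only [Finsupp.add_apply, Finsupp.equivFunOnFinite_symm_apply_apply, if_neg hcon.1,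
      Int.toNat_of_nonpos hcon.2, add_zero]

lemma lcNonzero.exists_card_add {I : Ideal (MvPolynomial ι K)} {i : ℕ} {α : ι → ℤ}
    (h : lcNonzero K I i α) : ∃ d ≤ Fintype.card ι, i = (negSupport α).card + d := by
  obtain ⟨d, hd, z, hz, -, hnz⟩ := h
  obtain ⟨σ, -, hσ⟩ := exists_card_eq_of_mem_cardFaces_ne_zero hz fun h0 =>
    hnz ⟨0, zero_mem _, by rw [map_zero, h0]⟩
  exact ⟨d, hσ ▸ Finset.card_le_univ σ, by omega⟩

lemma lcNonzero.of_degreeComplex_eq {I J : Ideal (MvPolynomial ι K)} {i : ℕ} {α β : ι → ℤ}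
    (h : lcNonzero K I i α) (hneg : negSupport β = negSupport α)
    (hdeg : degreeComplex K J β = degreeComplex K I α) : lcNonzero K J i β := by
  rwa [lcNonzero, hneg, hdeg]

lemma lcNonzero_symbolicPower_le {Δ : FaceSet ι} (hΔ : IsSimplicialComplex Δ) {N i : ℕ}
    {α : ι → ℤ} (h : lcNonzero K (symbolicPower (srIdeal K Δ) (N + 1)) i α) (j : ι) :
    α j ≤ N := by
  by_contra! hj
  refine not_hasNontrivialReducedHomology_of_cone (j := j) (fun F hF => ?_) _ h
  rw [mem_degreeComplex_symbolicPower hΔ] at hF ⊢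
  obtain ⟨hF0, H, hH, hsub, hlt⟩ := hF
  refine ⟨fun i hi => ?_, H, hH, ?_, hlt⟩
  · rcases Finset.mem_insert.1 hi with rfl | hi
    exacts [by omega, hF0 i hi]
  · rw [Finset.insert_union]
    refine Finset.insert_subset ?_ hsub
    by_contra hjH
    have := Finset.single_le_sum (s := Hᶜ) (f := fun i => (α i).toNat)
        (fun _ _ => Nat.zero_le _) (Finset.mem_compl.2 hjH)
    omega

lemma lcNonzero_srIdeal_le {Γ : FaceSet ι} (hΓ : IsSimplicialComplex Γ) {i : ℕ}
    {α : ι → ℤ} (h : lcNonzero K (srIdeal K Γ) i α) (j : ι) : α j ≤ 0 := by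
  by_contra! hj
  refine not_hasNontrivialReducedHomology_of_cone (j := j) (fun F hF => ?_) _ h
  rw [mem_degreeComplex_srIdeal hΓ] at hF ⊢
  refine ⟨fun i hi => ?_, ?_⟩
  · rcases Finset.mem_insert.1 hi with rfl | hi
    exacts [hj.le, hF.1 i hi]
  · rw [Finset.insert_union, Finset.insert_eq_of_mem]
    · exact hF.2
    · exact Finset.mem_union_right _ (by simpa using hj.ne')

end DegreeComplex

section Regularity

variable {K : Type*} [Field K] {ι : Type*}

/-- The exponent vector with entries `-1` on the negative support of `α`, and `t * α` elsewhere. -/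
def scaledExponent (t : ℕ) (α : ι → ℤ) (j : ι) : ℤ :=
  if α j < 0 then -1 else t * α j

lemma toNat_scaledExponent (t : ℕ) (α : ι → ℤ) (j : ι) :
    (scaledExponent t α j).toNat = t * (α j).toNat := by
  rw [scaledExponent]
  split_ifs with h
  · simp [Int.toNat_of_nonpos h.le]
  · rw [Int.toNat_mul (by omega) (by omega), Int.toNat_natCast]

variable [Fintype ι]

lemma sum_le_sum_toNat_sub_card_negSupport (α : ι → ℤ) :
    ∑ j, α j ≤ ((∑ j, (α j).toNat : ℕ) : ℤ) - (negSupport α).card := by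
  have h : ∀ j, α j ≤ ((α j).toNat : ℤ) - if α j < 0 then 1 else 0 := fun j => by
    split_ifs <;> omega
  refine (Finset.sum_le_sum fun j _ => h j).trans_eq ?_
  rw [Finset.sum_sub_distrib, Finset.sum_boole, Nat.cast_sum]
  rfl

lemma negSupport_scaledExponent (t : ℕ) (α : ι → ℤ) :
    negSupport (scaledExponent t α) = negSupport α := by
  ext j
  rw [mem_negSupport, mem_negSupport, scaledExponent]
  split_ifs with h
  · simp [h]
  · have : 0 ≤ (t : ℤ) * α j := mul_nonneg (by positivity) (by omega)
    omega

lemma sum_scaledExponent (t : ℕ) (α : ι → ℤ) :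
    ∑ j, scaledExponent t α j = t * ((∑ j, (α j).toNat : ℕ) : ℤ) - (negSupport α).card := by
  have h : ∀ j, scaledExponent t α j = t * ((α j).toNat : ℤ) - if α j < 0 then 1 else 0 :=
    fun j => by
      rw [scaledExponent]
      split_ifs with h
      · simp [Int.toNat_of_nonpos h.le]
      · rw [Int.toNat_of_nonneg (by omega), sub_zero]
  rw [Finset.sum_congr rfl fun j _ => h j, Finset.sum_sub_distrib, Finset.sum_boole, Nat.cast_sum,
    Finset.mul_sum]
  rfl

lemma nonneg_iff_notMem_negSupport {α : ι → ℤ} {j : ι} : 0 ≤ α j ↔ j ∉ negSupport α := by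
  rw [mem_negSupport, not_lt]

variable [LinearOrder ι]

lemma lcNonzero.scaledExponent_one {I : Ideal (MvPolynomial ι K)} {i : ℕ} {α : ι → ℤ}
    (h : lcNonzero K I i α) : lcNonzero K I i (scaledExponent 1 α) := by
  refine h.of_degreeComplex_eq (negSupport_scaledExponent 1 α) ?_
  simp only [degreeComplex, nonneg_iff_notMem_negSupport, negSupport_scaledExponent,
    toNat_scaledExponent, one_mul]

lemma lcNonzero.scaledExponent_symbolicPower {Δ : FaceSet ι} (hΔ : IsSimplicialComplex Δ)
    {N i t : ℕ} (ht : 0 < t) {α : ι → ℤ}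
    (h : lcNonzero K (symbolicPower (srIdeal K Δ) (N + 1)) i α) :
    lcNonzero K (symbolicPower (srIdeal K Δ) (t * N + 1)) i (scaledExponent t α) := by
  refine h.of_degreeComplex_eq (negSupport_scaledExponent t α) ?_
  ext F
  simp only [mem_degreeComplex_symbolicPower hΔ, nonneg_iff_notMem_negSupport,
    negSupport_scaledExponent, toNat_scaledExponent, ← Finset.mul_sum, Nat.lt_succ_iff,
    Nat.mul_le_mul_left_iff ht]

lemma bddAbove_of_lcNonzero_le {I : Ideal (MvPolynomial ι K)} {N : ℕ}
    (h : ∀ i α, lcNonzero K I i α → ∀ j, α j ≤ N) :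
    BddAbove {z : ℤ | ∃ (i : ℕ) (α : ι → ℤ), lcNonzero K I i α ∧ z = (∑ j, α j) + i} := by
  refine ⟨(Fintype.card ι * N : ℕ) + Fintype.card ι, ?_⟩
  rintro _ ⟨i, α, hα, rfl⟩
  obtain ⟨d, hd, rfl⟩ := hα.exists_card_add
  have h1 := sum_le_sum_toNat_sub_card_negSupport α
  have h2 : ∑ j, (α j).toNat ≤ Fintype.card ι * N := by
    refine (Finset.sum_le_card_nsmul _ _ N fun j _ => ?_).trans_eq (by simp)
    have := h _ _ hα j
    omega
  have h2' : ((∑ j, (α j).toNat : ℕ) : ℤ) ≤ (Fintype.card ι * N : ℕ) := Nat.cast_le.2 h2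
  have hd' : (d : ℤ) ≤ Fintype.card ι := Nat.cast_le.2 hd
  rw [Nat.cast_add]
  linarith

lemma bddAbove_symbolicPower {Δ : FaceSet ι} (hΔ : IsSimplicialComplex Δ) (N : ℕ) :
    BddAbove {z : ℤ | ∃ (i : ℕ) (α : ι → ℤ),
      lcNonzero K (symbolicPower (srIdeal K Δ) (N + 1)) i α ∧ z = (∑ j, α j) + i} :=
  bddAbove_of_lcNonzero_le fun _ _ h => lcNonzero_symbolicPower_le hΔ h

lemma bddAbove_srIdeal {Γ : FaceSet ι} (hΓ : IsSimplicialComplex Γ) :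
    BddAbove {z : ℤ | ∃ (i : ℕ) (α : ι → ℤ),
      lcNonzero K (srIdeal K Γ) i α ∧ z = (∑ j, α j) + i} :=
  bddAbove_of_lcNonzero_le (N := 0) fun _ _ h => lcNonzero_srIdeal_le hΓ h

lemma regQuot_nonneg (I : Ideal (MvPolynomial ι K)) : 0 ≤ regQuot K I := by
  rw [regQuot]
  by_cases hb : BddAbove {z : ℤ | ∃ (i : ℕ) (α : ι → ℤ), lcNonzero K I i α ∧ z = (∑ j, α j) + i}
  · rcases Set.eq_empty_or_nonempty
      {z : ℤ | ∃ (i : ℕ) (α : ι → ℤ), lcNonzero K I i α ∧ z = (∑ j, α j) + i} with he | hne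
    · rw [he, Int.csSup_empty]
    · obtain ⟨_, i, α, hα, -⟩ := hne
      refine le_trans ?_ (le_csSup hb ⟨i, _, hα.scaledExponent_one, rfl⟩)
      obtain ⟨d, -, rfl⟩ := hα.exists_card_add
      rw [sum_scaledExponent]
      push_cast
      have : (0 : ℤ) ≤ ∑ j, ((α j).toNat : ℤ) := Finset.sum_nonneg fun _ _ => by positivity
      lia
  · rw [Int.csSup_of_not_bddAbove hb]

lemma one_le_reg (I : Ideal (MvPolynomial ι K)) : 1 ≤ reg K I := by
  have := regQuot_nonneg I
  rw [reg]
  omega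

/-- The subcomplex of `Δ` whose facets are the facets of `Δ` which contain the negative support of
`α` and outside which the positive part of `α` has degree less than `n`. -/
def contributingComplex (Δ : FaceSet ι) (n : ℕ) (α : ι → ℤ) : FaceSet ι :=
  {F | ∃ H ∈ facets Δ, F ∪ negSupport α ⊆ H ∧ ∑ i ∈ Hᶜ, (α i).toNat < n}

lemma isSimplicialComplex_contributingComplex (Δ : FaceSet ι) (n : ℕ) (α : ι → ℤ) :
    IsSimplicialComplex (contributingComplex Δ n α) := by
  rintro σ ⟨H, hH, hsub, hlt⟩ τ hτ
  exact ⟨H, hH, (Finset.union_subset_union_left hτ).trans hsub, hlt⟩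

lemma contributingComplex_subset {Δ : FaceSet ι} (hΔ : IsSimplicialComplex Δ) (n : ℕ)
    (α : ι → ℤ) : contributingComplex Δ n α ⊆ Δ := by
  rintro F ⟨H, hH, hsub, -⟩
  exact hΔ H hH.1 F (Finset.subset_union_left.trans hsub)

lemma facets_contributingComplex_subset (Δ : FaceSet ι) (n : ℕ) (α : ι → ℤ) :
    facets (contributingComplex Δ n α) ⊆ facets Δ := by
  rintro F ⟨⟨H, hH, hsub, hlt⟩, hmax⟩
  rw [hmax H ⟨H, hH, Finset.union_subset subset_rfl (Finset.subset_union_right.trans hsub), hlt⟩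
    (Finset.subset_union_left.trans hsub)]
  exact hH

lemma lcNonzero.contributingComplex {Δ : FaceSet ι} (hΔ : IsSimplicialComplex Δ) {n i : ℕ}
    {α : ι → ℤ} (h : lcNonzero K (symbolicPower (srIdeal K Δ) n) i α) :
    lcNonzero K (srIdeal K (contributingComplex Δ n α)) i (scaledExponent 0 α) := by
  refine h.of_degreeComplex_eq (negSupport_scaledExponent 0 α) ?_
  ext F
  rw [mem_degreeComplex_srIdeal (isSimplicialComplex_contributingComplex Δ n α),
    mem_degreeComplex_symbolicPower hΔ]
  simp only [nonneg_iff_notMem_negSupport, negSupport_scaledExponent]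
  have : (Finset.univ.filter fun i => scaledExponent 0 α i ≠ 0) = negSupport α := by
    ext j
    simp [scaledExponent, mem_negSupport]
  rw [this, _root_.contributingComplex, Set.mem_ofPred_eq, Finset.union_assoc,
    Finset.union_idempotent]

/-- Dilating a contributing exponent bounds its positive part by the asymptotic slope. -/
lemma sum_toNat_le_of_tendsto {Δ : FaceSet ι} (hΔ : IsSimplicialComplex Δ) {δ : ℝ}
    (hδ : Tendsto (fun n : ℕ => (reg K (symbolicPower (srIdeal K Δ) n) : ℝ) / n) atTop (nhds δ))
    {N i : ℕ} {α : ι → ℤ}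
    (h : lcNonzero K (symbolicPower (srIdeal K Δ) (N + 1)) i α) :
    ((∑ j, (α j).toNat : ℕ) : ℝ) ≤ δ * N := by
  rcases Nat.eq_zero_or_pos N with rfl | hN
  · have : ∑ j, (α j).toNat = 0 := Finset.sum_eq_zero fun j _ => by
      have := lcNonzero_symbolicPower_le hΔ h j
      omega
    simp [this]
  have hlim : Tendsto (fun t : ℕ => t * N + 1) atTop atTop :=
    tendsto_atTop_mono (fun t => (Nat.le_mul_of_pos_right t hN).trans (Nat.le_succ _)) tendsto_id
  have hlim' : Tendsto (fun t : ℕ => (N : ℝ) + 1 / t) atTop (nhds (N + 0)) :=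
    tendsto_const_nhds.add tendsto_one_div_atTop_nhds_zero_nat
  rw [add_zero] at hlim'
  refine ge_of_tendsto ((hδ.comp hlim).mul hlim') ?_
  filter_upwards [eventually_gt_atTop 0] with t ht
  have hle := le_csSup (bddAbove_symbolicPower hΔ (t * N))
    ⟨i, _, h.scaledExponent_symbolicPower hΔ ht, rfl⟩
  rw [← regQuot, sum_scaledExponent] at hle
  obtain ⟨d, -, rfl⟩ := h.exists_card_add
  have hreg : (t * (∑ j, (α j).toNat : ℕ) : ℤ) ≤
      reg K (symbolicPower (srIdeal K Δ) (t * N + 1)) := by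
    rw [reg]
    push_cast at *
    lia
  have hreg' : (t * (∑ j, (α j).toNat : ℕ) : ℝ) ≤
      reg K (symbolicPower (srIdeal K Δ) (t * N + 1)) := by exact_mod_cast hreg
  have ht' : (0 : ℝ) < t := by exact_mod_cast ht
  have hpos : (0 : ℝ) < t * N + 1 := by positivity
  have : (reg K (symbolicPower (srIdeal K Δ) (t * N + 1)) : ℝ) / ((t * N + 1 : ℕ) : ℝ) *
      (N + 1 / t) = reg K (symbolicPower (srIdeal K Δ) (t * N + 1)) / t := by
    push_cast
    field_simp
  rw [Function.comp_apply, this, le_div_iff₀ ht', mul_comm]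
  exact hreg'

end Regularity

/-- For a simplicial complex `Δ` on `{1, …, r}` and all `n ≥ 1`:
`reg(I_Δ^{(n)}) ≤ δ(I_Δ)·(n − 1) + b`, where
`b = max{reg(I_Γ) : Γ subcomplex of Δ with F(Γ) ⊆ F(Δ)}`. -/
theorem statement1 {K : Type*} [Field K] {r : ℕ}
    (Δ : FaceSet (Fin r)) (hΔ : IsSimplicialComplex Δ)
    (δ : ℝ)
    (hδ : Filter.Tendsto (fun n : ℕ => (reg K (symbolicPower (srIdeal K Δ) n) : ℝ) / n)
      Filter.atTop (nhds δ))
    (b : ℤ)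
    (hb : IsGreatest {z : ℤ | ∃ Γ : FaceSet (Fin r), IsSimplicialComplex Γ ∧ Γ ⊆ Δ ∧
        facets Γ ⊆ facets Δ ∧ z = reg K (srIdeal K Γ)} b)
    (n : ℕ) (hn : 1 ≤ n) :
    (reg K (symbolicPower (srIdeal K Δ) n) : ℝ) ≤ δ * (n - 1) + b := by
  obtain ⟨N, rfl⟩ : ∃ N, n = N + 1 := ⟨n - 1, by omega⟩
  have hcast : (((N + 1 : ℕ) : ℝ) - 1) = N := by push_cast; ring
  rw [hcast]
  rcases Set.eq_empty_or_nonempty {z : ℤ | ∃ (i : ℕ) (α : Fin r → ℤ),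
      lcNonzero K (symbolicPower (srIdeal K Δ) (N + 1)) i α ∧ z = (∑ j, α j) + i} with he | hne
  · have hb1 : (1 : ℝ) ≤ b := by
      exact_mod_cast (one_le_reg (srIdeal K Δ)).trans (hb.2 ⟨Δ, hΔ, subset_rfl, subset_rfl, rfl⟩)
    have hδ0 : 0 ≤ δ := ge_of_tendsto' hδ fun m => by
      have : (1 : ℝ) ≤ reg K (symbolicPower (srIdeal K Δ) m) := by exact_mod_cast one_le_reg _
      positivity
    rw [reg, regQuot, he, Int.csSup_empty]
    have : 0 ≤ δ * N := by positivity
    push_cast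
    linarith
  · obtain ⟨i, α, hα, hmax⟩ := Int.csSup_mem hne (bddAbove_symbolicPower hΔ N)
    have hpos := sum_toNat_le_of_tendsto hΔ hδ hα
    have hΓ := isSimplicialComplex_contributingComplex Δ (N + 1) α
    have hle := le_csSup (bddAbove_srIdeal hΓ) ⟨i, _, hα.contributingComplex hΔ, rfl⟩
    rw [← regQuot, sum_scaledExponent] at hle
    have hbΓ := hb.2 ⟨_, hΓ, contributingComplex_subset hΔ (N + 1) α,
      facets_contributingComplex_subset Δ (N + 1) α, rfl⟩
    have hsum := sum_le_sum_toNat_sub_card_negSupport α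
    rw [reg] at hbΓ
    have hreg : reg K (symbolicPower (srIdeal K Δ) (N + 1)) ≤
        ((∑ j, (α j).toNat : ℕ) : ℤ) + b := by
      rw [reg, regQuot, hmax]
      push_cast at *
      lia
    have hreg' : (reg K (symbolicPower (srIdeal K Δ) (N + 1)) : ℝ) ≤
        ((∑ j, (α j).toNat : ℕ) : ℝ) + b := by exact_mod_cast hreg
    linarith
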